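/- Let A₁ = (0,−1) and let B₁ = (x₁,y₁), C₁ = (x₂,y₂), D₁ = (x₃,y₃) ∈ [−1,1] × [−1,1] satisfy: (i) x₁² + y₁² = 1, |x₁ − 1| ≤ 1/25, |y₁| ≤ 7/25; (ii) x₂² + y₂² = 1, |x₂ + 1| ≤ 1/25, |y₂| ≤ 7/25; (iii) |x₃| ≤ 7/25, |y₃ − 1| ≤ 1/25; (iv) the triangle A₁B₁C₁ contains the origin O = (0,0) in its interior or on its boundary. Then δ(A₁,B₁) + δ(B₁,C₁) + δ(C₁,A₁) + δ(A₁,D₁) + δ(B₁,D₁) + δ(C₁,D₁) ≤ 4 + 4√2, with equality if and only if B₁ = (1,0), C₁ = (−1,0), D₁ = (0,1). -/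

import Mathlib

/-- The warp distance between two points of the unit disk. -/
noncomputable def warpDist (P Q : ℝ × ℝ) : ℝ :=
  Real.sqrt (2 - 2 * P.1 * Q.1 - 2 * P.2 * Q.2)

/-- A quadratic upper bound for `√(2 + 2t)` near `t = 0`. -/
lemma sqrt_two_add_two_mul_le {t : ℝ} (h₁ : -(3 / 5) ≤ t) (h₂ : t ≤ 3 / 5) :
    √(2 + 2 * t) ≤ √2 * (1 + t / 2 - 9 / 100 * t ^ 2) := by
  have h_pos : 0 ≤ 1 + t / 2 - 9 / 100 * t ^ 2 := by nlinarith
  have h_sq : 1 + t ≤ (1 + t / 2 - 9 / 100 * t ^ 2) ^ 2 := by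
    have : 0 ≤ t ^ 2 * (7 / 100 - 9 / 100 * t + (9 / 100) ^ 2 * t ^ 2) :=
      mul_nonneg (sq_nonneg t) (by nlinarith [sq_nonneg t])
    nlinarith
  rw [Real.sqrt_le_left (by positivity), mul_pow, Real.sq_sqrt (by norm_num)]
  linarith

/-- A quantitative form of the warp sum bound, with an explicit deficit that vanishes only at the
extremal configuration. -/
lemma warp_sum_add_deficit_le {p b r c x y : ℝ}
    (hB : p ^ 2 + b ^ 2 = 1) (hp : |p - 1| ≤ 1 / 25) (hb : |b| ≤ 7 / 25)
    (hC : r ^ 2 + c ^ 2 = 1) (hr : |r + 1| ≤ 1 / 25) (hc : |c| ≤ 7 / 25)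
    (hx : |x| ≤ 7 / 25) (hy : |y - 1| ≤ 1 / 25) (hy₁ : y ≤ 1) :
    warpDist (0, -1) (p, b) + warpDist (p, b) (r, c) + warpDist (r, c) (0, -1) +
        warpDist (0, -1) (x, y) + warpDist (p, b) (x, y) + warpDist (r, c) (x, y) +
        (1 / 10 * (1 - y) + √2 * (1 / 100 * (b ^ 2 + c ^ 2) + 9 / 100 * (p * x + y * b) ^ 2))
      ≤ 4 + 4 * √2 := by
  rw [abs_le] at hp hb hr hc hx hy
  have hp₁ : p ≤ 1 := by linarith [sq_nonneg (p - 1), sq_nonneg b]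
  have hr₁ : -1 ≤ r := by linarith [sq_nonneg (r + 1), sq_nonneg c]
  have hAB : warpDist (0, -1) (p, b) ≤ √2 * (1 + b / 2 - 9 / 100 * b ^ 2) := by
    convert sqrt_two_add_two_mul_le (t := b) (by linarith) (by linarith) using 1
    simp only [warpDist]; ring_nf
  have hCA : warpDist (r, c) (0, -1) ≤ √2 * (1 + c / 2 - 9 / 100 * c ^ 2) := by
    convert sqrt_two_add_two_mul_le (t := c) (by linarith) (by linarith) using 1
    simp only [warpDist]; ring_nf
  have abs_mul_add_le : ∀ u v : ℝ, |u| ≤ 1 → |v| ≤ 7 / 25 → |u * x + y * v| ≤ 3 / 5 := by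
    intro u v hu hv
    have h₁ : |u * x| ≤ 1 * (7 / 25) := by
      rw [abs_mul]
      exact mul_le_mul hu (abs_le.2 hx) (abs_nonneg _) zero_le_one
    have h₂ : |y * v| ≤ 1 * (7 / 25) := by
      rw [abs_mul]
      exact mul_le_mul (abs_le.2 ⟨by linarith, hy₁⟩) hv (abs_nonneg _) zero_le_one
    linarith [abs_add_le (u * x) (y * v)]
  have hBD : warpDist (p, b) (x, y) ≤
      √2 * (1 + -(p * x + y * b) / 2 - 9 / 100 * (-(p * x + y * b)) ^ 2) := by
    have h := abs_le.1 (abs_mul_add_le p b (abs_le.2 ⟨by linarith, hp₁⟩) (abs_le.2 hb))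
    convert sqrt_two_add_two_mul_le (t := -(p * x + y * b)) (by linarith) (by linarith) using 1
    simp only [warpDist]; ring_nf
  have hCD : warpDist (r, c) (x, y) ≤
      √2 * (1 + -(r * x + y * c) / 2 - 9 / 100 * (-(r * x + y * c)) ^ 2) := by
    have h := abs_le.1 (abs_mul_add_le r c (abs_le.2 ⟨hr₁, by linarith⟩) (abs_le.2 hc))
    convert sqrt_two_add_two_mul_le (t := -(r * x + y * c)) (by linarith) (by linarith) using 1
    simp only [warpDist]; ring_nf
  have hBC : warpDist (p, b) (r, c) ≤ 2 := by
    simp only [warpDist]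
    rw [Real.sqrt_le_left (by norm_num)]
    nlinarith [sq_nonneg (p + r), sq_nonneg (b + c)]
  have hAD : warpDist (0, -1) (x, y) ≤ 2 - (1 - y) / 2 := by
    simp only [warpDist]
    rw [Real.sqrt_le_left (by linarith)]
    nlinarith [sq_nonneg (1 - y)]
  have h_cross : -(x * (p + r)) / 2 ≤ 8 / 100 * (b ^ 2 + c ^ 2) := by
    have h_eq : (p + r) * (p - r) = c ^ 2 - b ^ 2 := by linarith
    have h_abs : |p + r| * (48 / 25) ≤ b ^ 2 + c ^ 2 := by
      calc |p + r| * (48 / 25) ≤ |p + r| * |p - r| := by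
            gcongr
            exact le_trans (by linarith) (le_abs_self _)
        _ = |c ^ 2 - b ^ 2| := by rw [← abs_mul, h_eq]
        _ ≤ b ^ 2 + c ^ 2 := by
            rw [abs_le]
            constructor <;> linarith [sq_nonneg b, sq_nonneg c]
    have h_mul : |x * (p + r)| ≤ 7 / 25 * |p + r| := by
      rw [abs_mul]
      exact mul_le_mul_of_nonneg_right (abs_le.2 hx) (abs_nonneg _)
    linarith [neg_abs_le (x * (p + r)), sq_nonneg b, sq_nonneg c]
  have h_sqrt : √2 ≤ 10 / 7 := by
    rw [Real.sqrt_le_left (by norm_num)]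
    norm_num
  have h_lift : √2 * ((1 - y) * (b + c) / 2) ≤ 2 / 5 * (1 - y) := by
    have h : (1 - y) * (b + c) / 2 ≤ 7 / 25 * (1 - y) := by
      linarith [mul_le_mul_of_nonneg_left (show b + c ≤ 14 / 25 by linarith) (sub_nonneg.2 hy₁)]
    calc √2 * ((1 - y) * (b + c) / 2) ≤ √2 * (7 / 25 * (1 - y)) := by gcongr
      _ ≤ 10 / 7 * (7 / 25 * (1 - y)) := by
          have : 0 ≤ 1 - y := by linarith
          gcongr
      _ = 2 / 5 * (1 - y) := by ring
  have h_cross' := mul_le_mul_of_nonneg_left h_cross (Real.sqrt_nonneg 2)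
  have h_sq : 0 ≤ √2 * (9 / 100 * (r * x + y * c) ^ 2) := by positivity
  linarith

theorem warp_sum_le_with_equality_condition
    (B₁ C₁ D₁ : ℝ × ℝ)
    (hBbox : B₁.1 ∈ Set.Icc (-1 : ℝ) 1 ∧ B₁.2 ∈ Set.Icc (-1 : ℝ) 1)
    (hCbox : C₁.1 ∈ Set.Icc (-1 : ℝ) 1 ∧ C₁.2 ∈ Set.Icc (-1 : ℝ) 1)
    (hDbox : D₁.1 ∈ Set.Icc (-1 : ℝ) 1 ∧ D₁.2 ∈ Set.Icc (-1 : ℝ) 1)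
    (hB : B₁.1 ^ 2 + B₁.2 ^ 2 = 1) (hB1 : |B₁.1 - 1| ≤ 1/25) (hB2 : |B₁.2| ≤ 7/25)
    (hC : C₁.1 ^ 2 + C₁.2 ^ 2 = 1) (hC1 : |C₁.1 + 1| ≤ 1/25) (hC2 : |C₁.2| ≤ 7/25)
    (hD1 : |D₁.1| ≤ 7/25) (hD2 : |D₁.2 - 1| ≤ 1/25)
    (hO : ((0 : ℝ), (0 : ℝ)) ∈
      convexHull ℝ ({((0 : ℝ), (-1 : ℝ)), B₁, C₁} : Set (ℝ × ℝ))) :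
    warpDist ((0 : ℝ), (-1 : ℝ)) B₁ + warpDist B₁ C₁ + warpDist C₁ ((0 : ℝ), (-1 : ℝ)) +
        warpDist ((0 : ℝ), (-1 : ℝ)) D₁ + warpDist B₁ D₁ + warpDist C₁ D₁
      ≤ 4 + 4 * Real.sqrt 2 ∧
    (warpDist ((0 : ℝ), (-1 : ℝ)) B₁ + warpDist B₁ C₁ + warpDist C₁ ((0 : ℝ), (-1 : ℝ)) +
        warpDist ((0 : ℝ), (-1 : ℝ)) D₁ + warpDist B₁ D₁ + warpDist C₁ D₁
      = 4 + 4 * Real.sqrt 2 ↔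
      B₁ = ((1 : ℝ), (0 : ℝ)) ∧ C₁ = ((-1 : ℝ), (0 : ℝ)) ∧ D₁ = ((0 : ℝ), (1 : ℝ))) := by
  obtain ⟨p, b⟩ := B₁
  obtain ⟨r, c⟩ := C₁
  obtain ⟨x, y⟩ := D₁
  simp only at hDbox hB hB1 hB2 hC hC1 hC2 hD1 hD2
  have hy := hDbox.2.2
  have key := warp_sum_add_deficit_le hB hB1 hB2 hC hC1 hC2 hD1 hD2 hy
  have h_sqrt : 0 < √2 := by positivity
  have h_deficit : 0 ≤ √2 * (1 / 100 * (b ^ 2 + c ^ 2) + 9 / 100 * (p * x + y * b) ^ 2) := by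
    positivity
  refine ⟨by linarith, fun h => ?_, ?_⟩
  · have hy_eq : y = 1 := by linarith
    have h_zero : 1 / 100 * (b ^ 2 + c ^ 2) + 9 / 100 * (p * x + y * b) ^ 2 = 0 :=
      (mul_eq_zero.1 (by linarith)).resolve_left h_sqrt.ne'
    have hb : b = 0 := by
      rw [← sq_eq_zero_iff]; linarith [sq_nonneg b, sq_nonneg c, sq_nonneg (p * x + y * b)]
    have hc : c = 0 := by
      rw [← sq_eq_zero_iff]; linarith [sq_nonneg b, sq_nonneg c, sq_nonneg (p * x + y * b)]
    have hpx : p * x + y * b = 0 := by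
      rw [← sq_eq_zero_iff]; linarith [sq_nonneg b, sq_nonneg c, sq_nonneg (p * x + y * b)]
    subst hb hc hy_eq
    rw [abs_le] at hB1 hC1
    have hp : p = 1 := by nlinarith
    have hr : r = -1 := by nlinarith
    subst hp hr
    have hx : x = 0 := by linarith
    rw [hx]
    exact ⟨rfl, rfl, rfl⟩
  · simp only [Prod.mk.injEq]
    rintro ⟨⟨rfl, rfl⟩, ⟨rfl, rfl⟩, rfl, rfl⟩
    have h_four : √(4 : ℝ) = 2 := by
      rw [show (4 : ℝ) = 2 ^ 2 by norm_num]
      exact Real.sqrt_sq (by norm_num)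
    norm_num [warpDist, h_four]
    ring
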